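/- arXiv:1410.3682 — 2 statements merged into one kernel-verified Lean document; each statement's English description precedes it below -/
import Mathlib

section
/- Let A be a real l×m matrix satisfying the RIP of order 2s with constant δ₂ₛ ∈ (0,1) and the RIP of order 3s with constant δ₃ₛ < 1/3, where δ₂ₛ ≤ δ₃ₛ. Let h⋆ ∈ ℝᵐ have at most s nonzero entries and set y = A h⋆. Consider N nodes indexed by k = 1,…,N, with current estimates h₁,…,h_N ∈ ℝᵐ each having at most s nonzero entries, and let B = (b_{r,k}) be an N×N matrix with nonnegative entries whose rows and columns all sum to 1. For each node k let Sₖ be a set of s largest-magnitude indices of the proxy hₖ + Aᵀ(y − A hₖ); let ĥₖ be a minimizer of ‖y − A h‖₂ over all h ∈ ℝᵐ with support contained in Sₖ; let h̃ₖ = Σ_{r=1}^N b_{r,k} ĥ_r; let S̃ₖ be a set of s largest-magnitude indices of h̃ₖ and let hₖ⁺ be the restriction of h̃ₖ to S̃ₖ (entries outside S̃ₖ set to zero). Then, with ρ = √(8 δ₃ₛ² / (1 − δ₂ₛ²)), one has (Σ_{k=1}^N ‖hₖ⁺ − h⋆‖₂²)^{1/2} ≤ ρ · (Σ_{k=1}^N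 ‖hₖ − h⋆‖₂²)^{1/2}, and ρ < 1. -/
open Matrix
open scoped BigOperators

/-- The Euclidean (ℓ₂) norm of a vector in ℝⁿ. -/
noncomputable def l2norm {n : ℕ} (x : Fin n → ℝ) : ℝ := Real.sqrt (∑ i, (x i)^2)

/-- A vector has at most `s` nonzero entries. -/
def IsSparse {m : ℕ} (s : ℕ) (x : Fin m → ℝ) : Prop :=
  (Finset.univ.filter fun i => x i ≠ 0).card ≤ s

/-- `A` satisfies the restricted isometry property of order `k` with constant `δ`. -/
def SatisfiesRIP {l m : ℕ} (A : Matrix (Fin l) (Fin m) ℝ) (k : ℕ) (δ : ℝ) : Prop :=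
  ∀ x : Fin m → ℝ, IsSparse k x →
    (1 - δ) * (l2norm x)^2 ≤ (l2norm (A *ᵥ x))^2 ∧
      (l2norm (A *ᵥ x))^2 ≤ (1 + δ) * (l2norm x)^2

/-- `S` is a set of `s` largest-magnitude indices of `h`. -/
def IsLargestIndices {m : ℕ} (s : ℕ) (h : Fin m → ℝ) (S : Finset (Fin m)) : Prop :=
  S.card = s ∧ ∀ i ∈ S, ∀ j ∉ S, |h j| ≤ |h i|

/-- The restriction of `v` to `S`: equal to `v` on `S` and zero outside `S`. -/
def restrictVec {m : ℕ} (S : Finset (Fin m)) (v : Fin m → ℝ) : Fin m → ℝ :=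
  fun i => if i ∈ S then v i else 0

/-- `hhat` minimizes `‖y − A u‖₂` over all `u` with support contained in `S`. -/
def IsLSMinimizerOn {l m : ℕ} (A : Matrix (Fin l) (Fin m) ℝ) (y : Fin l → ℝ)
    (S : Finset (Fin m)) (hhat : Fin m → ℝ) : Prop :=
  (∀ i, hhat i ≠ 0 → i ∈ S) ∧
  ∀ u : Fin m → ℝ, (∀ i, u i ≠ 0 → i ∈ S) →
    l2norm (y - A *ᵥ hhat) ≤ l2norm (y - A *ᵥ u)

lemma l2norm_sq {n : ℕ} (x : Fin n → ℝ) : l2norm x ^ 2 = x ⬝ᵥ x := by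
  rw [l2norm, Real.sq_sqrt (Finset.sum_nonneg fun i _ => sq_nonneg _)]
  simp [dotProduct, sq]

lemma dotProduct_self_nonneg_real {n : ℕ} (x : Fin n → ℝ) : 0 ≤ x ⬝ᵥ x :=
  l2norm_sq x ▸ sq_nonneg _

lemma IsSparse.of_support_subset {m k : ℕ} {x : Fin m → ℝ} {W : Finset (Fin m)}
    (hx : ∀ i, x i ≠ 0 → i ∈ W) (hW : W.card ≤ k) : IsSparse k x :=
  (Finset.card_le_card fun i hi => hx i (Finset.mem_filter.mp hi).2).trans hW

/-- A matrix with the RIP nearly preserves inner products of vectors with a common small support. -/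
lemma SatisfiesRIP.sq_dotProduct_sub_le {l m k : ℕ} {A : Matrix (Fin l) (Fin m) ℝ} {δ : ℝ}
    (hA : SatisfiesRIP A k δ) {W : Finset (Fin m)} (hW : W.card ≤ k) {a b : Fin m → ℝ}
    (ha : ∀ i, a i ≠ 0 → i ∈ W) (hb : ∀ i, b i ≠ 0 → i ∈ W) :
    (a ⬝ᵥ b - (A *ᵥ a) ⬝ᵥ (A *ᵥ b)) ^ 2 ≤ δ ^ 2 * (a ⬝ᵥ a) * (b ⬝ᵥ b) := by
  have expand (n : ℕ) (p q : Fin n → ℝ) (t u : ℝ) : (t • p + u • q) ⬝ᵥ (t • p + u • q) =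
      t ^ 2 * (p ⬝ᵥ p) + 2 * t * u * (p ⬝ᵥ q) + u ^ 2 * (q ⬝ᵥ q) := by
    simp only [add_dotProduct, dotProduct_add, smul_dotProduct, dotProduct_smul, smul_eq_mul,
      dotProduct_comm q p]
    ring
  have key (t u : ℝ) := hA (t • a + u • b) <| .of_support_subset (W := W) (fun i hi => by
    by_contra hiW
    have h1 : a i = 0 := by_contra fun h => hiW (ha i h)
    have h2 : b i = 0 := by_contra fun h => hiW (hb i h)
    simp [h1, h2] at hi) hW
  simp only [l2norm_sq, mulVec_add, mulVec_smul, expand] at key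
  have haa := dotProduct_self_nonneg_real a
  have hbb := dotProduct_self_nonneg_real b
  set p := a ⬝ᵥ b
  set q := (A *ᵥ a) ⬝ᵥ (A *ᵥ b)
  set α := a ⬝ᵥ a
  set β := b ⬝ᵥ b
  rcases haa.eq_or_lt with h0 | hapos
  · have : a = 0 := dotProduct_self_eq_zero.mp h0.symm
    simp [p, q, ← h0, this]
  rcases hbb.eq_or_lt with h0 | hbpos
  · have : b = 0 := dotProduct_self_eq_zero.mp h0.symm
    simp [p, q, ← h0, this]
  have hsα := Real.sqrt_pos.mpr hapos
  have hsβ := Real.sqrt_pos.mpr hbpos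
  have eα := Real.sq_sqrt haa
  have eβ := Real.sq_sqrt hbb
  set σ := √α
  set τ := √β
  have h1 := key τ σ
  have h2 := key τ (-σ)
  have hprod : 0 < σ * τ := mul_pos hsα hsβ
  rw [← eα, ← eβ] at h1 h2 ⊢
  have hle : p - q ≤ δ * (σ * τ) := by
    refine le_of_mul_le_mul_left ?_ hprod
    linarith [h1.1, h2.2]
  have hge : -(δ * (σ * τ)) ≤ p - q := by
    refine le_of_mul_le_mul_left ?_ hprod
    linarith [h1.2, h2.1]
  calc (p - q) ^ 2 ≤ (δ * (σ * τ)) ^ 2 := sq_le_sq' hge hle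
    _ = δ ^ 2 * σ ^ 2 * τ ^ 2 := by ring

/-- If `z` is the restriction of `x - AᵀA x` to `U`, then RIP bounds `‖z‖` by `δ ‖x‖`. -/
lemma SatisfiesRIP.restrict_dotProduct_self_le {l m k : ℕ} {A : Matrix (Fin l) (Fin m) ℝ} {δ : ℝ}
    (hA : SatisfiesRIP A k δ) {W : Finset (Fin m)} (hW : W.card ≤ k) {z x : Fin m → ℝ}
    (hz : ∀ i, z i ≠ 0 → i ∈ W) (hx : ∀ i, x i ≠ 0 → i ∈ W)
    (h : z ⬝ᵥ z = z ⬝ᵥ x - (A *ᵥ z) ⬝ᵥ (A *ᵥ x)) :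
    z ⬝ᵥ z ≤ δ ^ 2 * (x ⬝ᵥ x) := by
  have key := hA.sq_dotProduct_sub_le hW hz hx
  rw [← h] at key
  rcases (dotProduct_self_nonneg_real z).eq_or_lt with h0 | hpos
  · rw [← h0]
    exact mul_nonneg (sq_nonneg _) (dotProduct_self_nonneg_real x)
  · refine le_of_mul_le_mul_left ?_ hpos
    linarith

lemma restrictVec_dotProduct {m : ℕ} (S : Finset (Fin m)) (v w : Fin m → ℝ) :
    restrictVec S v ⬝ᵥ w = ∑ i ∈ S, v i * w i := by
  simp [restrictVec, dotProduct, ite_mul]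

lemma restrictVec_dotProduct_self {m : ℕ} (S : Finset (Fin m)) (v : Fin m → ℝ) :
    restrictVec S v ⬝ᵥ restrictVec S v = ∑ i ∈ S, v i ^ 2 := by
  rw [restrictVec_dotProduct]
  exact Finset.sum_congr rfl fun i hi => by simp [restrictVec, hi, sq]

lemma mem_of_restrictVec_ne_zero {m : ℕ} {S : Finset (Fin m)} {v : Fin m → ℝ} {i : Fin m}
    (hi : restrictVec S v i ≠ 0) : i ∈ S :=
  by_contra fun h => hi (by simp [restrictVec, h])

lemma IsLargestIndices.sum_sdiff_sq_le {m s : ℕ} {v : Fin m → ℝ} {S T : Finset (Fin m)}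
    (hS : IsLargestIndices s v S) (hT : T.card ≤ s) :
    ∑ i ∈ T \ S, v i ^ 2 ≤ ∑ i ∈ S \ T, v i ^ 2 := by
  have hcard : (T \ S).card ≤ (S \ T).card := by
    have h1 := Finset.card_sdiff_add_card_inter T S
    have h2 := Finset.card_sdiff_add_card_inter S T
    rw [Finset.inter_comm] at h2
    have := hS.1
    omega
  rcases (S \ T).eq_empty_or_nonempty with h0 | hne
  · have : T \ S = ∅ := Finset.card_eq_zero.mp (by simpa [h0] using hcard)
    simp [h0, this]
  obtain ⟨i₀, hi₀, hmin⟩ := Finset.exists_min_image _ (fun i => v i ^ 2) hne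
  calc ∑ i ∈ T \ S, v i ^ 2 ≤ (T \ S).card • v i₀ ^ 2 :=
        Finset.sum_le_card_nsmul _ _ _ fun j hj => sq_le_sq.mpr <|
          hS.2 i₀ (Finset.mem_sdiff.mp hi₀).1 j (Finset.mem_sdiff.mp hj).2
    _ ≤ (S \ T).card • v i₀ ^ 2 := nsmul_le_nsmul_left (sq_nonneg _) hcard
    _ ≤ ∑ i ∈ S \ T, v i ^ 2 := Finset.card_nsmul_le_sum _ _ _ hmin

/-- Hard thresholding at most doubles the distance to any sparse vector. -/
lemma IsLargestIndices.restrictVec_sub_dotProduct_self_le {m s : ℕ} {v x : Fin m → ℝ}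
    {S : Finset (Fin m)} (hS : IsLargestIndices s v S) (hx : IsSparse s x) :
    (restrictVec S v - x) ⬝ᵥ (restrictVec S v - x) ≤ 4 * ((v - x) ⬝ᵥ (v - x)) := by
  set T := Finset.univ.filter fun i => x i ≠ 0
  have hxT (i) (hi : i ∉ T) : x i = 0 := by simpa [T] using hi
  have hST := hS.sum_sdiff_sq_le (T := T) hx
  have hbest : ∑ i ∈ Sᶜ, v i ^ 2 ≤ (v - x) ⬝ᵥ (v - x) := by
    have e1 : ∑ i ∈ Sᶜ, v i ^ 2 = ∑ i ∈ T \ S, v i ^ 2 + ∑ i ∈ (S ∪ T)ᶜ, v i ^ 2 := by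
      rw [← Finset.sum_union (by
        rw [Finset.disjoint_left]; intro i; simp; tauto)]
      congr 1; ext i; simp; tauto
    have e2 : ∑ i ∈ S \ T, v i ^ 2 + ∑ i ∈ (S ∪ T)ᶜ, v i ^ 2 = ∑ i ∈ Tᶜ, v i ^ 2 := by
      rw [← Finset.sum_union (by
        rw [Finset.disjoint_left]; intro i; simp; tauto)]
      congr 1; ext i; simp; tauto
    have e3 : ∑ i ∈ Tᶜ, v i ^ 2 = ∑ i ∈ Tᶜ, (v i - x i) ^ 2 :=
      Finset.sum_congr rfl fun i hi => by rw [hxT i (Finset.mem_compl.mp hi), sub_zero]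
    have e4 : ∑ i ∈ Tᶜ, (v i - x i) ^ 2 ≤ ∑ i, (v i - x i) ^ 2 :=
      Finset.sum_le_sum_of_subset_of_nonneg (Finset.subset_univ _) fun _ _ _ => sq_nonneg _
    have e5 : (v - x) ⬝ᵥ (v - x) = ∑ i, (v i - x i) ^ 2 := by simp [dotProduct, sq]
    linarith
  have htail : ∑ i, (restrictVec S v i - v i) ^ 2 = ∑ i ∈ Sᶜ, v i ^ 2 := by
    rw [← Finset.sum_subset (Finset.subset_univ Sᶜ)]
    · exact Finset.sum_congr rfl fun i hi => by
        simp [restrictVec, Finset.mem_compl.mp hi]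
    · intro i _ hi
      simp [restrictVec, Finset.mem_compl.not_left.mp hi]
  have hpar : (restrictVec S v - x) ⬝ᵥ (restrictVec S v - x) ≤
      2 * (∑ i, (restrictVec S v i - v i) ^ 2) + 2 * ((v - x) ⬝ᵥ (v - x)) := by
    simp only [dotProduct, Finset.mul_sum, ← Finset.sum_add_distrib, Pi.sub_apply]
    exact Finset.sum_le_sum fun i _ => by
      nlinarith [sq_nonneg (restrictVec S v i - v i - (v i - x i))]
  linarith

/-- The least-squares residual is orthogonal to the range of `A` on the chosen support. -/
lemma IsLSMinimizerOn.dotProduct_residual_eq_zero {l m : ℕ} {A : Matrix (Fin l) (Fin m) ℝ}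
    {y : Fin l → ℝ} {S : Finset (Fin m)} {x : Fin m → ℝ} (hx : IsLSMinimizerOn A y S x)
    {z : Fin m → ℝ} (hz : ∀ i, z i ≠ 0 → i ∈ S) : (A *ᵥ z) ⬝ᵥ (y - A *ᵥ x) = 0 := by
  set r := y - A *ᵥ x with hr
  set p := (A *ᵥ z) ⬝ᵥ r
  set q := (A *ᵥ z) ⬝ᵥ (A *ᵥ z)
  have hq : 0 ≤ q := dotProduct_self_nonneg_real _
  have key (t : ℝ) : 0 ≤ q * t ^ 2 - 2 * t * p := by
    have h1 := hx.2 (x + t • z) fun i hi => by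
      by_contra hiS
      have h1 : x i = 0 := by_contra fun h => hiS (hx.1 i h)
      have h2 : z i = 0 := by_contra fun h => hiS (hz i h)
      simp [h1, h2] at hi
    have h2 := pow_le_pow_left₀ (show 0 ≤ l2norm _ from Real.sqrt_nonneg _) h1 2
    rw [l2norm_sq, l2norm_sq, mulVec_add, mulVec_smul, ← sub_sub, ← hr] at h2
    simp only [sub_dotProduct, dotProduct_sub, smul_dotProduct, dotProduct_smul, smul_eq_mul,
      dotProduct_comm r (A *ᵥ z)] at h2
    linarith
  have h := key (p / (q + 1))
  have hq1 : 0 < q + 1 := by linarith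
  have e : q * (p / (q + 1)) ^ 2 - 2 * (p / (q + 1)) * p = -(p ^ 2 * (q + 2) / (q + 1) ^ 2) := by
    field_simp
    ring
  rw [e] at h
  by_contra hne
  have : 0 < p ^ 2 * (q + 2) / (q + 1) ^ 2 := by positivity
  linarith

/-- Least squares on `S` is controlled by the part of the target that `S` misses. -/
lemma IsLSMinimizerOn.error_le {l m s : ℕ} {A : Matrix (Fin l) (Fin m) ℝ} {δ : ℝ}
    (hA : SatisfiesRIP A (2 * s) δ) {S T : Finset (Fin m)} (hS : S.card = s) (hT : T.card ≤ s)
    {x u : Fin m → ℝ} (hxT : ∀ i, x i ≠ 0 → i ∈ T) (hu : IsLSMinimizerOn A (A *ᵥ x) S u) :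
    (1 - δ ^ 2) * ((u - x) ⬝ᵥ (u - x)) ≤ ∑ i ∈ T \ S, x i ^ 2 := by
  set e := x - u with he
  have hcard : (S ∪ T).card ≤ 2 * s := by have := Finset.card_union_le S T; omega
  have heW (i) (hi : e i ≠ 0) : i ∈ S ∪ T := by
    by_contra h
    rw [Finset.mem_union, not_or] at h
    have h1 : x i = 0 := by_contra fun hn => h.2 (hxT i hn)
    have h2 : u i = 0 := by_contra fun hn => h.1 (hu.1 i hn)
    simp [he, h1, h2] at hi
  have horth : (A *ᵥ restrictVec S e) ⬝ᵥ (A *ᵥ e) = 0 := by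
    rw [he, mulVec_sub]
    exact hu.dotProduct_residual_eq_zero fun i hi => mem_of_restrictVec_ne_zero hi
  have hbound := hA.restrict_dotProduct_self_le hcard (z := restrictVec S e)
    (fun i hi => Finset.mem_union_left _ (mem_of_restrictVec_ne_zero hi)) heW (by
      rw [horth, sub_zero, restrictVec_dotProduct_self, restrictVec_dotProduct]
      simp only [sq])
  rw [restrictVec_dotProduct_self] at hbound
  have hsplit : e ⬝ᵥ e = ∑ i ∈ S, e i ^ 2 + ∑ i ∈ T \ S, x i ^ 2 := by
    have h1 : ∑ i ∈ T \ S, x i ^ 2 = ∑ i ∈ Sᶜ, e i ^ 2 := by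
      rw [← Finset.sum_subset (s₁ := T \ S) (s₂ := Sᶜ)]
      · refine Finset.sum_congr rfl fun i hi => ?_
        have : u i = 0 := by_contra fun hn => (Finset.mem_sdiff.mp hi).2 (hu.1 i hn)
        simp [he, this]
      · intro i hi
        simpa using (Finset.mem_sdiff.mp hi).2
      · intro i hi hn
        by_contra h0
        have := heW i (fun h => h0 (by simp [h]))
        simp_all
    rw [h1, Finset.sum_add_sum_compl]
    simp [dotProduct, sq]
  have hflip : (u - x) ⬝ᵥ (u - x) = e ⬝ᵥ e := by
    rw [he, ← neg_sub x u, neg_dotProduct_neg]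
  rw [hflip]
  linarith

/-- The support selected from the proxy captures most of the target's energy. -/
lemma IsLargestIndices.sum_sdiff_sq_le_of_proxy {l m s : ℕ} {A : Matrix (Fin l) (Fin m) ℝ} {δ : ℝ}
    (hA : SatisfiesRIP A (3 * s) δ) {S T : Finset (Fin m)} (hT : T.card ≤ s)
    {x u : Fin m → ℝ} (hxT : ∀ i, x i ≠ 0 → i ∈ T) (hu : IsSparse s u)
    (hS : IsLargestIndices s (u + Aᵀ *ᵥ (A *ᵥ x - A *ᵥ u)) S) :
    ∑ i ∈ T \ S, x i ^ 2 ≤ 2 * δ ^ 2 * ((u - x) ⬝ᵥ (u - x)) := by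
  set v := u + Aᵀ *ᵥ (A *ᵥ x - A *ᵥ u) with hv
  set e := u - x with he
  set w := e - Aᵀ *ᵥ (A *ᵥ e) with hw
  have hvw : v = x + w := by
    rw [hv, hw, he, mulVec_sub A u x, mulVec_sub, mulVec_sub]
    abel
  set U := (T \ S) ∪ (S \ T) with hU
  set W := (S ∪ T) ∪ Finset.univ.filter fun i => u i ≠ 0
  have hcard : W.card ≤ 3 * s := by
    have h1 : W.card ≤ _ := Finset.card_union_le (S ∪ T) (Finset.univ.filter fun i => u i ≠ 0)
    have h2 := Finset.card_union_le S T
    have h3 : (Finset.univ.filter fun i => u i ≠ 0).card ≤ s := hu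
    have h4 := hS.1
    omega
  have heW (i) (hi : e i ≠ 0) : i ∈ W := by
    by_contra h
    simp only [W, Finset.mem_union, Finset.mem_filter, Finset.mem_univ, true_and, not_or,
      not_not] at h
    have h1 : x i = 0 := by_contra fun hn => h.1.2 (hxT i hn)
    simp [he, h1, h.2] at hi
  have hbound := hA.restrict_dotProduct_self_le hcard (z := restrictVec U w) (x := e)
    (fun i hi => by
      have := mem_of_restrictVec_ne_zero hi
      simp only [hU, Finset.mem_union, Finset.mem_sdiff] at this
      simp only [W, Finset.mem_union]
      tauto) heW (by
      have h1 : (A *ᵥ restrictVec U w) ⬝ᵥ (A *ᵥ e) = restrictVec U w ⬝ᵥ (Aᵀ *ᵥ (A *ᵥ e)) := by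
        rw [mulVec_transpose, dotProduct_comm, dotProduct_mulVec, dotProduct_comm]
      rw [h1, ← dotProduct_sub, ← hw, restrictVec_dotProduct_self, restrictVec_dotProduct]
      simp only [sq])
  rw [restrictVec_dotProduct_self, hU, Finset.sum_union (by
    rw [Finset.disjoint_left]; intro i; simp; tauto)] at hbound
  have hcmp := hS.sum_sdiff_sq_le hT
  have h1 : ∑ i ∈ S \ T, v i ^ 2 = ∑ i ∈ S \ T, w i ^ 2 :=
    Finset.sum_congr rfl fun i hi => by
      have : x i = 0 := by_contra fun hn => (Finset.mem_sdiff.mp hi).2 (hxT i hn)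
      simp [hvw, this]
  have h2 : ∑ i ∈ T \ S, x i ^ 2 ≤ ∑ i ∈ T \ S, 2 * (v i ^ 2 + w i ^ 2) :=
    Finset.sum_le_sum fun i _ => by
      rw [show x i = v i - w i by simp [hvw]]
      nlinarith [sq_nonneg (v i + w i)]
  rw [← Finset.mul_sum, Finset.sum_add_distrib] at h2
  linarith

/-- Averaging with doubly stochastic weights does not increase the total squared error. -/
lemma sum_dotProduct_self_average_le {m N : ℕ} {B : Matrix (Fin N) (Fin N) ℝ}
    (hB0 : ∀ r k, 0 ≤ B r k) (hBrow : ∀ r, ∑ k, B r k = 1) (hBcol : ∀ k, ∑ r, B r k = 1)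
    (f : Fin N → Fin m → ℝ) (x : Fin m → ℝ) :
    ∑ k, ((∑ r, B r k • f r) - x) ⬝ᵥ ((∑ r, B r k • f r) - x) ≤
      ∑ r, (f r - x) ⬝ᵥ (f r - x) := by
  have hk (k : Fin N) : ((∑ r, B r k • f r) - x) ⬝ᵥ ((∑ r, B r k • f r) - x) ≤
      ∑ r, B r k * ((f r - x) ⬝ᵥ (f r - x)) := by
    simp only [dotProduct, Finset.mul_sum]
    rw [Finset.sum_comm]
    refine Finset.sum_le_sum fun i _ => ?_
    have hi : ((∑ r, B r k • f r) - x) i = ∑ r, B r k * (f r i - x i) := by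
      simp [mul_sub, Finset.sum_sub_distrib, ← Finset.sum_mul, hBcol k]
    rw [hi, ← sq]
    simpa [sq] using (even_two.convexOn_pow (𝕜 := ℝ)).map_sum_le (t := Finset.univ)
      (w := fun r => B r k) (p := fun r => f r i - x i) (fun r _ => hB0 r k) (hBcol k) (by simp)
  refine (Finset.sum_le_sum fun k _ => hk k).trans_eq ?_
  rw [Finset.sum_comm]
  simp [← Finset.sum_mul, hBrow]

/-- One-step contraction of the DiHaT iteration across the network. -/
theorem dihat_one_step_contraction
    (l m s N : ℕ) (A : Matrix (Fin l) (Fin m) ℝ) (δ₂ δ₃ : ℝ)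
    (hδ₂0 : 0 < δ₂) (hδ₂1 : δ₂ < 1) (hδ₃ : δ₃ < 1/3) (hδle : δ₂ ≤ δ₃)
    (hRIP2 : SatisfiesRIP A (2*s) δ₂) (hRIP3 : SatisfiesRIP A (3*s) δ₃)
    (hstar : Fin m → ℝ) (hstar_sparse : IsSparse s hstar)
    (y : Fin l → ℝ) (hy : y = A *ᵥ hstar)
    (h : Fin N → Fin m → ℝ) (hh_sparse : ∀ k, IsSparse s (h k))
    (B : Matrix (Fin N) (Fin N) ℝ) (hB0 : ∀ r k, 0 ≤ B r k)
    (hBrow : ∀ r, ∑ k, B r k = 1) (hBcol : ∀ k, ∑ r, B r k = 1)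
    (S : Fin N → Finset (Fin m))
    (hS : ∀ k, IsLargestIndices s (h k + Aᵀ *ᵥ (y - A *ᵥ h k)) (S k))
    (hhat : Fin N → Fin m → ℝ)
    (hhat_min : ∀ k, IsLSMinimizerOn A y (S k) (hhat k))
    (htilde : Fin N → Fin m → ℝ)
    (htilde_def : ∀ k, htilde k = ∑ r, B r k • hhat r)
    (Stilde : Fin N → Finset (Fin m))
    (hStilde : ∀ k, IsLargestIndices s (htilde k) (Stilde k))
    (hplus : Fin N → Fin m → ℝ)
    (hplus_def : ∀ k, hplus k = restrictVec (Stilde k) (htilde k)) :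
    Real.sqrt (∑ k, (l2norm (hplus k - hstar))^2) ≤
      Real.sqrt (8 * δ₃^2 / (1 - δ₂^2)) * Real.sqrt (∑ k, (l2norm (h k - hstar))^2) ∧
    Real.sqrt (8 * δ₃^2 / (1 - δ₂^2)) < 1 := by
  have hδpos : 0 < 1 - δ₂ ^ 2 := by nlinarith
  constructor
  · rw [← Real.sqrt_mul (by positivity)]
    refine Real.sqrt_le_sqrt ?_
    simp only [l2norm_sq]
    set T := Finset.univ.filter fun i => hstar i ≠ 0
    have hT (i) (hi : hstar i ≠ 0) : i ∈ T := by simpa [T] using hi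
    subst hy
    have hlocal (k : Fin N) : (hhat k - hstar) ⬝ᵥ (hhat k - hstar) ≤
        2 * δ₃ ^ 2 / (1 - δ₂ ^ 2) * ((h k - hstar) ⬝ᵥ (h k - hstar)) := by
      rw [div_mul_eq_mul_div, le_div_iff₀' hδpos]
      exact ((hhat_min k).error_le hRIP2 (hS k).1 hstar_sparse hT).trans
        ((hS k).sum_sdiff_sq_le_of_proxy hRIP3 hstar_sparse hT (hh_sparse k))
    calc ∑ k, (hplus k - hstar) ⬝ᵥ (hplus k - hstar)
        ≤ ∑ k, 4 * ((htilde k - hstar) ⬝ᵥ (htilde k - hstar)) :=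
          Finset.sum_le_sum fun k _ => by
            rw [hplus_def k]
            exact (hStilde k).restrictVec_sub_dotProduct_self_le hstar_sparse
      _ = 4 * ∑ k, (htilde k - hstar) ⬝ᵥ (htilde k - hstar) := by rw [Finset.mul_sum]
      _ ≤ 4 * ∑ r, (hhat r - hstar) ⬝ᵥ (hhat r - hstar) := by
          simp only [htilde_def]
          exact mul_le_mul_of_nonneg_left
            (sum_dotProduct_self_average_le hB0 hBrow hBcol hhat hstar) zero_le_four
      _ ≤ 4 * ∑ k, 2 * δ₃ ^ 2 / (1 - δ₂ ^ 2) * ((h k - hstar) ⬝ᵥ (h k - hstar)) := by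
          gcongr with k
          exact hlocal k
      _ = 8 * δ₃ ^ 2 / (1 - δ₂ ^ 2) * ∑ k, (h k - hstar) ⬝ᵥ (h k - hstar) := by
          rw [← Finset.mul_sum]
          ring
  · rw [Real.sqrt_lt' one_pos, one_pow, div_lt_one hδpos]
    nlinarith
end

section
/- Let g ∈ ℝᵐ, let S = {i : g_i ≠ 0} be its support nonempty with |S| = s, and let (gₙ) be a sequence in ℝᵐ converging to g. Then there exists n₀ such that for every n ≥ n₀, every set T ⊆ {1,…,m} of cardinality s satisfying |gₙ(i)| ≥ |gₙ(j)| for all i ∈ T and j ∉ T is equal to S. -/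
open Matrix
open scoped BigOperators

/-- Support identification: if a sequence of proxies converges to a vector whose
support has exactly `s` elements, every selected set of `s` largest-magnitude
indices eventually equals the true support. -/
theorem eventual_support_identification
    (m s : ℕ) (g : Fin m → ℝ)
    (S : Finset (Fin m)) (hSdef : S = Finset.univ.filter fun i => g i ≠ 0)
    (hS_nonempty : S.Nonempty) (hScard : S.card = s)
    (gseq : ℕ → Fin m → ℝ)
    (hconv : Filter.Tendsto gseq Filter.atTop (nhds g)) :
    ∃ n₀ : ℕ, ∀ n ≥ n₀, ∀ T : Finset (Fin m),
      T.card = s → (∀ i ∈ T, ∀ j ∉ T, |gseq n j| ≤ |gseq n i|) → T = S := by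
  have hlt : ∀ᶠ n in Filter.atTop, ∀ i j, g i ≠ 0 → g j = 0 → |gseq n j| < |gseq n i| := by
    refine Filter.eventually_all.2 fun i => Filter.eventually_all.2 fun j => ?_
    by_cases hij : g i ≠ 0 ∧ g j = 0
    · have hcoord := tendsto_pi_nhds.1 hconv
      have habs : |g j| < |g i| := by simpa [hij.2] using hij.1
      filter_upwards [(hcoord j).abs.eventually_lt (hcoord i).abs habs] with n hn _ _
      exact hn
    · exact .of_forall fun n hi hj => absurd ⟨hi, hj⟩ hij
  obtain ⟨n₀, hn₀⟩ := Filter.eventually_atTop.1 hlt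
  refine ⟨n₀, fun n hn T hT hTmax => ?_⟩
  have hcard : T.card = S.card := hT.trans hScard.symm
  by_contra hne
  obtain ⟨i, hiT, hiS⟩ := Finset.not_subset.1 fun h => hne (Finset.eq_of_subset_of_card_le h hcard.ge)
  obtain ⟨j, hjS, hjT⟩ := Finset.not_subset.1 fun h =>
    hne (Finset.eq_of_subset_of_card_le h hcard.le).symm
  have hi : g i = 0 := by simpa [hSdef] using hiS
  have hj : g j ≠ 0 := by simpa [hSdef] using hjS
  exact (hn₀ n hn j i hj hi).not_ge (hTmax i hiT j hjT)
end
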